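/- Let k ∈ ℤ^n with k ≥ 0. For every proper ordered partition E_1|E_2|…|E_l of the multiset [k] there exists a unique ordered partition λ = B_1|…|B_l ∈ P_{⊞^k} such that B̄_r = E_r for all r ∈ {1,…,l}. Consequently, the map U_k : P_{⊞^k} → R^{pr}_k, λ = B_1|…|B_l ↦ λ̄ = B̄_1|…|B̄_l, is an isomorphism of posets (order-preserving bijection with order-preserving inverse, with respect to the refinement orders). -/

import Mathlib

section Core

variable {A : Type*} [DecidableEq A] [Fintype A]

/-- A cube of the standard `A`-cube: `none` means `*`, `some true` means `1`,
`some false` means `0`. -/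
abbrev Cube (A : Type*) := A → Option Bool

/-- The cube `c(O, S, rest)` with value `1` on `O`, `*` on `S` and `0` elsewhere. -/
def cubeOn (O S : Finset A) : Cube A := fun a =>
  if a ∈ S then none else if a ∈ O then some true else some false

/-- An `A`-cubical complex: a set of cubes closed under the face maps, i.e. under
replacing any occurrence of `*` by `0` or `1`. -/
def IsComplex (K : Set (Cube A)) : Prop :=
  ∀ c ∈ K, ∀ a : A, c a = none → ∀ ε : Bool, Function.update c a (some ε) ∈ K

/-- Union of the blocks of a list of finsets. -/
def blocksUnion (L : List (Finset A)) : Finset A := L.foldr (· ∪ ·) ∅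

/-- `L` is an ordered partition of `S`: a sequence of nonempty pairwise disjoint
subsets whose union is `S`. -/
def IsOPart (S : Finset A) (L : List (Finset A)) : Prop :=
  (∀ B ∈ L, B.Nonempty) ∧
    List.Pairwise (fun B C : Finset A => Disjoint B C) L ∧ blocksUnion L = S

/-- The set `P_K` of ordered partitions `L = B₁|…|B_l` of `S` such that each cube
`c((O ∪ B₁∪…∪B_{i-1}), B_i, rest)` belongs to `K`.  Here `O` records the part of the
ambient set on which the cubes take the fixed value `1` (used for the restrictions
`K|_B^ε`); for the full complex take `O = ∅`, `S = univ`. -/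
def PK (K : Set (Cube A)) (O S : Finset A) : Set (List (Finset A)) :=
  {L | IsOPart S L ∧ ∀ (i : ℕ) (h : i < L.length),
    cubeOn (O ∪ blocksUnion (L.take i)) (L[i]'h) ∈ K}

/-- `x` refines `y`: the blocks of `y` are obtained by uniting consecutive blocks of `x`. -/
def Refines (x y : List (Finset A)) : Prop :=
  ∃ LL : List (List (Finset A)), (∀ l ∈ LL, l ≠ []) ∧
    x = LL.flatten ∧ y = LL.map blocksUnion

/-- Dimension of an ordered partition: `Σ (#Bᵢ - 1)`. -/
def pdim (L : List (Finset A)) : ℕ := (L.map fun B => B.card - 1).sum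

/-- The facet relation on ordered partitions. -/
def PFacet (x y : List (Finset A)) : Prop :=
  Refines x y ∧ x ≠ y ∧ pdim y = pdim x + 1

/-- A cycle of a discrete vector field on a poset of ordered partitions. -/
def PCycle (V : Set (List (Finset A) × List (Finset A))) (k : ℕ)
    (a : Fin (k + 1) → List (Finset A)) (b : Fin k → List (Finset A)) : Prop :=
  0 < k ∧ a 0 = a (Fin.last k) ∧
    ∀ i : Fin k, (a i.castSucc, b i) ∈ V ∧ (a i.succ, b i) ∉ V ∧ PFacet (a i.succ) (b i)

/-- A discrete vector field on ordered partitions is a gradient field if it has no cycle. -/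
def PGradient (V : Set (List (Finset A) × List (Finset A))) : Prop :=
  ∀ k a b, ¬ PCycle V k a b

/-- Critical cells of a discrete vector field `V` on the set of cells `S`. -/
def CritOn (S : Set (List (Finset A)))
    (V : Set (List (Finset A) × List (Finset A))) : Set (List (Finset A)) :=
  {x | x ∈ S ∧ ∀ p ∈ V, p.1 ≠ x ∧ p.2 ≠ x}

end Core
section Eucl

variable {n : ℕ}

/-- The set `A_k = {(i,j) : 1 ≤ i ≤ n, 1 ≤ j ≤ k_i}`; the element `⟨i, j⟩` with
`j : Fin (k i)` represents the pair `(i, j+1)` of the paper. -/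
abbrev AkT (k : Fin n → ℕ) := Σ i : Fin n, Fin (k i)

/-- The value `j` of an element `(i,j) ∈ A_k`, as an integer. -/
def jval {k : Fin n → ℕ} (p : AkT k) : ℤ := ((p.2 : ℕ) : ℤ) + 1

/-- `[a,b]` is an elementary cube: `a ≤ b ≤ a + 1` coordinatewise. -/
def IsElemCube (a b : Fin n → ℤ) : Prop := a ≤ b ∧ ∀ i, b i ≤ a i + 1

/-- The cube `i_k([a,b])` of the standard `A_k`-cube associated to an elementary
cube `[a,b] ⊆ [0,k]`. -/
def ik (k : Fin n → ℕ) (a b : Fin n → ℤ) : Cube (AkT k) := fun p =>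
  if b p.1 < jval p then some false
  else if jval p ≤ a p.1 then some true
  else none

/-- `⊞^k`: the `A_k`-cubical complex of images under `i_k` of all elementary cubes
contained in `[0,k]`. -/
def boxK (k : Fin n → ℕ) : Set (Cube (AkT k)) :=
  {c | ∃ a b : Fin n → ℤ, IsElemCube a b ∧ 0 ≤ a ∧ (∀ i, b i ≤ (k i : ℤ)) ∧
    c = ik k a b}

/-- The multiset `B̄` over `{1,…,n}` associated to `B ⊆ A_k`, as its multiplicity
function: `i` has multiplicity `#{j : (i,j) ∈ B}`. -/
def mulOf {k : Fin n → ℕ} (B : Finset (AkT k)) : Fin n → ℕ := fun i =>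
  (B.filter fun p => p.1 = i).card

/-- Sum of the multiplicity functions of a list of multisets over `{1,…,n}`. -/
def sumMul (Lb : List (Fin n → ℕ)) : Fin n → ℕ := fun i =>
  (Lb.map fun c => c i).sum

/-- An ordered partition of the multiset `[k]`: a sequence of nonempty multisets
over `{1,…,n}` (given by multiplicity functions) summing to `k`. -/
def IsMPart (k : Fin n → ℕ) (Lb : List (Fin n → ℕ)) : Prop :=
  (∀ c ∈ Lb, c ≠ 0) ∧ sumMul Lb = k

/-- A proper ordered partition of `[k]`: all blocks are sets. -/
def IsProperMPart (k : Fin n → ℕ) (Lb : List (Fin n → ℕ)) : Prop :=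
  IsMPart k Lb ∧ ∀ c ∈ Lb, ∀ i, c i ≤ 1

end Eucl

/-- Refinement of ordered partitions of a multiset (given by multiplicity functions). -/
def RefinesM {n : ℕ} (x y : List (Fin n → ℕ)) : Prop :=
  ∃ LL : List (List (Fin n → ℕ)), (∀ l ∈ LL, l ≠ []) ∧
    x = LL.flatten ∧ y = LL.map sumMul

section Canonical

variable {n : ℕ} {k : Fin n → ℕ}

/-- The set of `(i, j) ∈ A_k` with `s i < j ≤ s i + c i` (in the 1-based numbering). -/
def intervalBlock (k s c : Fin n → ℕ) : Finset (AkT k) :=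
  Finset.univ.filter fun p => s p.1 ≤ (p.2 : ℕ) ∧ (p.2 : ℕ) < s p.1 + c p.1

/-- The consecutive interval blocks with multiplicities `Lb`, starting above `s`. -/
def intervalBlocks (k : Fin n → ℕ) :
    (Fin n → ℕ) → List (Fin n → ℕ) → List (Finset (AkT k))
  | _, [] => []
  | s, c :: Lb => intervalBlock k s c :: intervalBlocks k (s + c) Lb

@[simp]
theorem mem_intervalBlock {s c : Fin n → ℕ} {p : AkT k} :
    p ∈ intervalBlock k s c ↔ s p.1 ≤ (p.2 : ℕ) ∧ (p.2 : ℕ) < s p.1 + c p.1 := by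
  simp [intervalBlock]

@[simp]
theorem sumMul_nil : sumMul ([] : List (Fin n → ℕ)) = 0 := rfl

@[simp]
theorem sumMul_cons (c : Fin n → ℕ) (Lb : List (Fin n → ℕ)) :
    sumMul (c :: Lb) = c + sumMul Lb := by
  ext i; simp [sumMul]

@[simp]
theorem blocksUnion_nil {A : Type*} [DecidableEq A] :
    blocksUnion ([] : List (Finset A)) = ∅ := rfl

@[simp]
theorem blocksUnion_cons {A : Type*} [DecidableEq A] (B : Finset A) (L : List (Finset A)) :
    blocksUnion (B :: L) = B ∪ blocksUnion L := rfl

theorem mem_blocksUnion {A : Type*} [DecidableEq A] {L : List (Finset A)} {a : A} :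
    a ∈ blocksUnion L ↔ ∃ B ∈ L, a ∈ B := by
  induction L with
  | nil => simp
  | cons B L ih => simp [ih]

theorem mulOf_intervalBlock {s c : Fin n → ℕ} (h : s + c ≤ k) :
    mulOf (intervalBlock k s c) = c := by
  ext i
  have hi : s i + c i ≤ k i := h i
  have key : ((intervalBlock k s c).filter fun p => p.1 = i).card =
      (Finset.Ico (s i) (s i + c i)).card := by
    refine Finset.card_bij (fun p _ => (p.2 : ℕ)) ?_ ?_ ?_
    · rintro ⟨i', j⟩ hp
      simp only [Finset.mem_filter, mem_intervalBlock] at hp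
      obtain ⟨hp, rfl⟩ := hp
      simpa using hp
    · rintro ⟨i₁, j₁⟩ h₁ ⟨i₂, j₂⟩ h₂ hj
      simp only [Finset.mem_filter] at h₁ h₂
      obtain ⟨-, rfl⟩ := h₁
      obtain ⟨-, rfl⟩ := h₂
      exact congrArg _ (Fin.ext hj)
    · intro j hj
      rw [Finset.mem_Ico] at hj
      exact ⟨⟨i, ⟨j, by omega⟩⟩, by simpa using hj, rfl⟩
  simpa [mulOf] using key

theorem intervalBlock_union (s c d : Fin n → ℕ) :
    intervalBlock k s c ∪ intervalBlock k (s + c) d = intervalBlock k s (c + d) := by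
  ext p
  simp only [Finset.mem_union, mem_intervalBlock, Pi.add_apply]
  omega

theorem blocksUnion_intervalBlocks (s : Fin n → ℕ) (Lb : List (Fin n → ℕ)) :
    blocksUnion (intervalBlocks k s Lb) = intervalBlock k s (sumMul Lb) := by
  induction Lb generalizing s with
  | nil => ext p; simp [intervalBlocks]
  | cons c Lb ih => simp [intervalBlocks, ih, intervalBlock_union]

theorem intervalBlocks_append (s : Fin n → ℕ) (Lb Lb' : List (Fin n → ℕ)) :
    intervalBlocks k s (Lb ++ Lb') =
      intervalBlocks k s Lb ++ intervalBlocks k (s + sumMul Lb) Lb' := by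
  induction Lb generalizing s with
  | nil => simp [intervalBlocks]
  | cons c Lb ih => simp [intervalBlocks, ih, add_assoc]

theorem intervalBlocks_refines (s : Fin n → ℕ) (MM : List (List (Fin n → ℕ)))
    (hMM : ∀ m ∈ MM, m ≠ []) :
    Refines (intervalBlocks k s MM.flatten) (intervalBlocks k s (MM.map sumMul)) := by
  induction MM generalizing s with
  | nil => exact ⟨[], by simp, rfl, rfl⟩
  | cons m MM ih =>
    rw [List.forall_mem_cons] at hMM
    obtain ⟨LL, h, h₁, h₂⟩ := ih (s + sumMul m) hMM.2
    refine ⟨intervalBlocks k s m :: LL, ?_, ?_, ?_⟩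
    · refine List.forall_mem_cons.2 ⟨?_, h⟩
      cases m with
      | nil => exact absurd rfl hMM.1
      | cons c m => simp [intervalBlocks]
    · simp [intervalBlocks_append, h₁]
    · simp [intervalBlocks, blocksUnion_intervalBlocks, h₂]

theorem mulOf_union {B C : Finset (AkT k)} (h : Disjoint B C) :
    mulOf (B ∪ C) = mulOf B + mulOf C := by
  ext i
  simp only [mulOf, Pi.add_apply, Finset.filter_union]
  exact Finset.card_union_of_disjoint (Finset.disjoint_filter_filter h)

theorem mulOf_blocksUnion {L : List (Finset (AkT k))}
    (h : L.Pairwise fun B C => Disjoint B C) :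
    mulOf (blocksUnion L) = sumMul (L.map fun B => mulOf B) := by
  induction L with
  | nil => ext i; simp [mulOf]
  | cons B L ih =>
    rw [List.pairwise_cons] at h
    rw [blocksUnion_cons, mulOf_union, ih h.2, List.map_cons, sumMul_cons]
    rw [Finset.disjoint_left]
    intro a ha ha'
    obtain ⟨C, hC, haC⟩ := mem_blocksUnion.1 ha'
    exact Finset.disjoint_left.1 (h.1 C hC) ha haC

theorem cubeOn_intervalBlock_mem {s c : Fin n → ℕ} (hc : ∀ i, c i ≤ 1) (h : s + c ≤ k) :
    cubeOn (intervalBlock k 0 s) (intervalBlock k s c) ∈ boxK k := by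
  obtain ⟨a, ha⟩ : ∃ a : Fin n → ℤ, ∀ i, a i = s i := ⟨_, fun _ => rfl⟩
  obtain ⟨b, hb⟩ : ∃ b : Fin n → ℤ, ∀ i, b i = s i + c i := ⟨_, fun _ => rfl⟩
  refine ⟨a, b, ⟨fun i => ?_, fun i => ?_⟩, fun i => ?_, fun i => ?_, ?_⟩
  · simp [ha, hb]
  · have := hc i
    rw [ha, hb]
    omega
  · simp [ha]
  · have : s i + c i ≤ k i := h i
    rw [hb]
    omega
  · funext p
    have hap := ha p.1
    have hbp := hb p.1
    have hj : jval p = (p.2 : ℕ) + 1 := rfl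
    simp only [cubeOn, ik, mem_intervalBlock, Pi.zero_apply]
    split_ifs <;> first | rfl | omega

theorem eq_intervalBlock_of_cubeOn_mem {s : Fin n → ℕ} (hs : s ≤ k) {B : Finset (AkT k)}
    (hB : Disjoint (intervalBlock k 0 s) B) (h : cubeOn (intervalBlock k 0 s) B ∈ boxK k) :
    B = intervalBlock k s (mulOf B) ∧ s + mulOf B ≤ k ∧ ∀ i, mulOf B i ≤ 1 := by
  obtain ⟨a, b, ⟨hab, hba⟩, ha, hb, hc⟩ := h
  have hmem (p : AkT k) :
      (p ∈ B ↔ a p.1 < jval p ∧ jval p ≤ b p.1) ∧ ((p.2 : ℕ) < s p.1 ↔ jval p ≤ a p.1) := by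
    have hp := congrFun hc p
    have hd : p ∈ intervalBlock k 0 s → p ∉ B := fun h => Finset.disjoint_left.1 hB h
    have := hab p.1
    simp only [mem_intervalBlock, Pi.zero_apply, zero_le, zero_add, true_and] at hd
    simp only [cubeOn, ik, mem_intervalBlock, Pi.zero_apply, zero_le, zero_add, true_and] at hp
    split_ifs at hp <;> simp_all <;> omega
  have hsa (i : Fin n) : (s i : ℤ) = a i := by
    have h₁ : s i ≤ k i := hs i
    have h₂ : 0 ≤ a i := ha i
    have h₃ : a i ≤ b i := hab i
    have h₄ := hb i
    have lo : 0 < s i → (s i : ℤ) ≤ a i := fun h => by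
      have := (hmem ⟨i, ⟨s i - 1, by omega⟩⟩).2
      simp only [jval] at this
      omega
    have hi : s i < k i → a i ≤ s i := fun h => by
      have := (hmem ⟨i, ⟨s i, h⟩⟩).2
      simp only [jval] at this
      omega
    omega
  obtain ⟨c, hbc⟩ : ∃ c : Fin n → ℕ, ∀ i, b i = s i + c i :=
    ⟨fun i => (b i - a i).toNat, fun i => by
      have : a i ≤ b i := hab i
      have := hsa i
      dsimp only
      omega⟩
  have hck : s + c ≤ k := fun i => by
    have := hb i; have := hbc i; simp only [Pi.add_apply]; omega
  have hBc : B = intervalBlock k s c := by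
    ext p
    rw [(hmem p).1, mem_intervalBlock, ← hsa, hbc, jval]
    omega
  have hm : mulOf B = c := by rw [hBc, mulOf_intervalBlock hck]
  rw [hm]
  exact ⟨hBc, hck, fun i => by have := hba i; have := hbc i; have := hsa i; omega⟩

theorem forall_cubeOn_cons {A : Type*} [DecidableEq A] {K : Set (Cube A)} {O B : Finset A}
    {L : List (Finset A)} :
    (∀ (i : ℕ) (h : i < (B :: L).length),
      cubeOn (O ∪ blocksUnion ((B :: L).take i)) ((B :: L)[i]'h) ∈ K) ↔
    cubeOn O B ∈ K ∧ ∀ (i : ℕ) (h : i < L.length),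
      cubeOn ((O ∪ B) ∪ blocksUnion (L.take i)) (L[i]'h) ∈ K := by
  constructor
  · intro h
    refine ⟨by simpa using! h 0 (by simp), fun i hi => ?_⟩
    simpa [Finset.union_assoc] using! h (i + 1) (by simpa using hi)
  · rintro ⟨h₀, h⟩ (_ | i) hi
    · simpa using h₀
    · simpa [Finset.union_assoc] using h i (by simpa using hi)

theorem intervalBlock_zero_union (s c : Fin n → ℕ) :
    intervalBlock k 0 s ∪ intervalBlock k s c = intervalBlock k 0 (s + c) := by
  simpa using intervalBlock_union (k := k) 0 s c

theorem eq_intervalBlocks {L : List (Finset (AkT k))} {s : Fin n → ℕ} (hs : s ≤ k)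
    (hd : ∀ B ∈ L, Disjoint (intervalBlock k 0 s) B)
    (hL : L.Pairwise fun B C => Disjoint B C)
    (h : ∀ (i : ℕ) (h : i < L.length),
      cubeOn (intervalBlock k 0 s ∪ blocksUnion (L.take i)) (L[i]'h) ∈ boxK k) :
    L = intervalBlocks k s (L.map fun B => mulOf B) ∧ ∀ B ∈ L, ∀ i, mulOf B i ≤ 1 := by
  induction L generalizing s with
  | nil => simp [intervalBlocks]
  | cons B L ih =>
    rw [forall_cubeOn_cons] at h
    rw [List.pairwise_cons] at hL
    rw [List.forall_mem_cons] at hd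
    obtain ⟨hB, hk, h1⟩ := eq_intervalBlock_of_cubeOn_mem hs hd.1 h.1
    have hu : intervalBlock k 0 s ∪ B = intervalBlock k 0 (s + mulOf B) := by
      rw [← intervalBlock_zero_union, ← hB]
    rw [hu] at h
    obtain ⟨e, h1'⟩ := ih hk (fun C hC => by
      rw [← hu, Finset.disjoint_union_left]
      exact ⟨hd.2 C hC, hL.1 C hC⟩) hL.2 h.2
    refine ⟨?_, List.forall_mem_cons.2 ⟨h1, h1'⟩⟩
    rw [List.map_cons, intervalBlocks, ← hB, ← e]

theorem intervalBlock_zero_self : intervalBlock k 0 k = Finset.univ := by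
  ext p
  simp

theorem eq_intervalBlocks_of_mem_PK {L : List (Finset (AkT k))}
    (h : L ∈ PK (boxK k) ∅ Finset.univ) :
    L = intervalBlocks k 0 (L.map fun B => mulOf B) ∧
      IsProperMPart k (L.map fun B => mulOf B) := by
  obtain ⟨⟨hne, hd, hu⟩, hK⟩ := h
  have h0 : intervalBlock k 0 0 = ∅ := by ext p; simp
  obtain ⟨e, h1⟩ := eq_intervalBlocks (zero_le : (0 : Fin n → ℕ) ≤ k) (by simp [h0]) hd
    (by simpa only [h0] using hK)
  refine ⟨e, ⟨?_, ?_⟩, by simpa using h1⟩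
  · simp only [List.mem_map, forall_exists_index, and_imp, forall_apply_eq_imp_iff₂]
    intro B hB hz
    obtain ⟨p, hp⟩ := hne B hB
    have := congrFun hz p.1
    rw [mulOf, Pi.zero_apply, Finset.card_eq_zero] at this
    exact Finset.notMem_empty p (this ▸ Finset.mem_filter.2 ⟨hp, rfl⟩)
  · rw [← mulOf_blocksUnion hd, hu, ← intervalBlock_zero_self,
      mulOf_intervalBlock (by simp)]

theorem map_mulOf_intervalBlocks {s : Fin n → ℕ} {Lb : List (Fin n → ℕ)}
    (h : s + sumMul Lb ≤ k) :
    (intervalBlocks k s Lb).map (fun B => mulOf B) = Lb := by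
  induction Lb generalizing s with
  | nil => rfl
  | cons c Lb ih =>
    rw [sumMul_cons, ← add_assoc] at h
    rw [intervalBlocks, List.map_cons, ih h, mulOf_intervalBlock (le_self_add.trans h)]

theorem intervalBlocks_pairwise (s : Fin n → ℕ) (Lb : List (Fin n → ℕ)) :
    (intervalBlocks k s Lb).Pairwise fun B C => Disjoint B C := by
  induction Lb generalizing s with
  | nil => simp [intervalBlocks]
  | cons c Lb ih =>
    refine List.pairwise_cons.2 ⟨fun C hC => Finset.disjoint_left.2 fun p hp hpC => ?_, ih _⟩
    have : p ∈ blocksUnion (intervalBlocks k (s + c) Lb) := mem_blocksUnion.2 ⟨C, hC, hpC⟩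
    rw [blocksUnion_intervalBlocks] at this
    simp only [mem_intervalBlock, Pi.add_apply] at this hp
    omega

theorem cubeOn_intervalBlocks_mem {s : Fin n → ℕ} {Lb : List (Fin n → ℕ)}
    (hLb : ∀ c ∈ Lb, ∀ i, c i ≤ 1) (h : s + sumMul Lb ≤ k) :
    ∀ (i : ℕ) (h : i < (intervalBlocks k s Lb).length),
      cubeOn (intervalBlock k 0 s ∪ blocksUnion ((intervalBlocks k s Lb).take i))
        ((intervalBlocks k s Lb)[i]'h) ∈ boxK k := by
  induction Lb generalizing s with
  | nil => simp [intervalBlocks]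
  | cons c Lb ih =>
    rw [sumMul_cons, ← add_assoc] at h
    rw [List.forall_mem_cons] at hLb
    simp only [intervalBlocks]
    rw [forall_cubeOn_cons, intervalBlock_zero_union]
    exact ⟨cubeOn_intervalBlock_mem hLb.1 (le_self_add.trans h), ih hLb.2 h⟩

theorem intervalBlocks_mem_PK {Lb : List (Fin n → ℕ)} (h : IsProperMPart k Lb) :
    intervalBlocks k 0 Lb ∈ PK (boxK k) ∅ Finset.univ := by
  obtain ⟨⟨hne, hsum⟩, h1⟩ := h
  have hk : 0 + sumMul Lb ≤ k := by simp [hsum]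
  refine ⟨⟨fun B hB => ?_, intervalBlocks_pairwise 0 Lb, ?_⟩, ?_⟩
  · rw [Finset.nonempty_iff_ne_empty]
    rintro rfl
    have hm := List.mem_map_of_mem (f := fun B => mulOf B) hB
    rw [map_mulOf_intervalBlocks hk] at hm
    exact hne _ hm (by ext i; simp [mulOf])
  · rw [blocksUnion_intervalBlocks, hsum, intervalBlock_zero_self]
  · have h0 : intervalBlock k 0 0 = ∅ := by ext p; simp
    simpa only [h0] using cubeOn_intervalBlocks_mem h1 hk

theorem Refines.map_mulOf {L L' : List (Finset (AkT k))}
    (hL : L.Pairwise fun B C => Disjoint B C) (h : Refines L L') :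
    RefinesM (L.map fun B => mulOf B) (L'.map fun B => mulOf B) := by
  obtain ⟨LL, hne, rfl, rfl⟩ := h
  refine ⟨LL.map fun l => l.map fun B => mulOf B, by simpa using hne, ?_, ?_⟩
  · rw [List.map_flatten]
  · simp only [List.map_map]
    exact List.map_congr_left fun l hl => mulOf_blocksUnion ((List.pairwise_flatten.1 hL).1 l hl)

end Canonical

/-- For every proper ordered partition `E₁|…|E_l` of the multiset
`[k]` there is a unique `λ = B₁|…|B_l ∈ P_{⊞^k}` with `B̄_r = E_r` for all `r`;
consequently `U_k : λ ↦ λ̄` is an isomorphism of posets from `P_{⊞^k}` onto `R^{pr}_k`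
(an order-preserving bijection with order-preserving inverse, w.r.t. refinement). -/
theorem stmt_16 (n : ℕ) (k : Fin n → ℕ) :
    (∀ Lb : List (Fin n → ℕ), IsProperMPart k Lb →
      ∃! L : List (Finset (AkT k)),
        L ∈ PK (boxK k) ∅ Finset.univ ∧ L.map (fun B => mulOf B) = Lb) ∧
    Set.BijOn (fun L : List (Finset (AkT k)) => L.map fun B => mulOf B)
      (PK (boxK k) ∅ Finset.univ) {Lb | IsProperMPart k Lb} ∧
    ∀ L L' : List (Finset (AkT k)),
      L ∈ PK (boxK k) ∅ Finset.univ → L' ∈ PK (boxK k) ∅ Finset.univ →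
        (Refines L L' ↔
          RefinesM (L.map fun B => mulOf B) (L'.map fun B => mulOf B)) := by
  have hmap {Lb : List (Fin n → ℕ)} (h : IsProperMPart k Lb) :
      (intervalBlocks k 0 Lb).map (fun B => mulOf B) = Lb :=
    map_mulOf_intervalBlocks (by simp [h.1.2])
  refine ⟨fun Lb h => ⟨intervalBlocks k 0 Lb, ⟨intervalBlocks_mem_PK h, hmap h⟩, ?_⟩,
    ⟨fun L hL => (eq_intervalBlocks_of_mem_PK hL).2, fun L hL L' hL' e => ?_,
      fun Lb h => ⟨_, intervalBlocks_mem_PK h, hmap h⟩⟩,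
    fun L L' hL hL' => ⟨fun h => h.map_mulOf hL.1.2.1, ?_⟩⟩
  · rintro L ⟨hL, rfl⟩
    exact (eq_intervalBlocks_of_mem_PK hL).1
  · dsimp only at e
    rw [(eq_intervalBlocks_of_mem_PK hL).1, (eq_intervalBlocks_of_mem_PK hL').1, e]
  · rintro ⟨MM, hne, e, e'⟩
    rw [(eq_intervalBlocks_of_mem_PK hL).1, (eq_intervalBlocks_of_mem_PK hL').1, e, e']
    exact intervalBlocks_refines 0 MM hne
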